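/- arXiv:2605.23430 — 2 statements merged into one kernel-verified Lean document; each statement's English description precedes it below -/
import Mathlib

section
/- (Ptolemy's theorem 2, Lorentzian form.) Let n ≥ 2 and let v₁, …, v_{n+2} be vectors in Lorentzian space ℝ^{n,1} with ‖v_i‖² = −1 and positive last coordinate (points of hyperbolic space). Let B be the (n+2)×(n+2) matrix with entries B_{ij} = −½(⟨v_i, v_j⟩ + 1). Then det B = 0 if and only if there exist a nonzero vector v ∈ ℝ^{n+1} and a real number μ with μ² + ‖v‖² > 0 and ⟨v_i, v⟩ = μ for all i (i.e. the points lie on a common horosphere, hypersphere, hyperplane, or one branch of an equidistant hypersurface). -/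
/-- The Lorentzian bilinear form on `ℝ^{n,1}`:
`⟨x,y⟩ = x₁y₁ + ⋯ + xₙyₙ − x_{n+1}y_{n+1}`. -/
def lorentz {n : ℕ} (x y : Fin (n + 1) → ℝ) : ℝ :=
  (∑ i : Fin n, x i.castSucc * y i.castSucc) - x (Fin.last n) * y (Fin.last n)

/-- The matrix whose rows are the lightlike lifts `(v i, 1)` of the points `v i`. -/
def liftMatrix {n : ℕ} (v : Fin (n + 2) → (Fin (n + 1) → ℝ)) :
    Matrix (Fin (n + 2)) (Fin (n + 2)) ℝ :=
  Matrix.of fun i => Fin.snoc (α := fun _ => ℝ) (v i) 1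

/-- The diagonal of the Gram matrix of the form `-(⟨x, y⟩ + s t) / 2` on `ℝ^{n,1} × ℝ`. -/
noncomputable def liftSignature (n : ℕ) : Fin (n + 2) → ℝ :=
  Fin.snoc (α := fun _ => ℝ) (Fin.snoc (α := fun _ => ℝ) (fun _ : Fin n => -1 / 2) (1 / 2)) (-1 / 2)

theorem liftSignature_ne_zero (n : ℕ) (i : Fin (n + 2)) : liftSignature n i ≠ 0 := by
  refine Fin.lastCases ?_ (fun i => Fin.lastCases ?_ (fun i => ?_) i) i <;>
    simp [liftSignature]

theorem gram_eq_liftMatrix_mul {n : ℕ} (v : Fin (n + 2) → (Fin (n + 1) → ℝ)) :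
    (Matrix.of fun i j : Fin (n + 2) => -(lorentz (v i) (v j) + 1) / 2) =
      liftMatrix v * Matrix.diagonal (liftSignature n) * (liftMatrix v).transpose := by
  ext i j
  have h : ∑ k : Fin n, v i k.castSucc * (-1 / 2) * v j k.castSucc =
      (-1 / 2) * ∑ k : Fin n, v i k.castSucc * v j k.castSucc := by
    rw [Finset.mul_sum]
    exact Finset.sum_congr rfl fun k _ => by ring
  rw [Matrix.mul_apply]
  simp only [Matrix.mul_diagonal, Matrix.transpose_apply, Matrix.of_apply, liftMatrix,
    liftSignature, Fin.sum_univ_castSucc, Fin.snoc_castSucc, Fin.snoc_last, h, lorentz]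
  ring

theorem det_gram_eq_zero_iff_det_liftMatrix {n : ℕ} (v : Fin (n + 2) → (Fin (n + 1) → ℝ)) :
    Matrix.det (Matrix.of fun i j : Fin (n + 2) => -(lorentz (v i) (v j) + 1) / 2) = 0 ↔
      (liftMatrix v).det = 0 := by
  have h : ∏ i, liftSignature n i ≠ 0 :=
    Finset.prod_ne_zero_iff.mpr fun i _ => liftSignature_ne_zero n i
  rw [gram_eq_liftMatrix_mul, Matrix.det_mul, Matrix.det_mul, Matrix.det_transpose,
    Matrix.det_diagonal]
  simp [h]

theorem det_liftMatrix_eq_zero_iff {n : ℕ} (v : Fin (n + 2) → (Fin (n + 1) → ℝ)) :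
    (liftMatrix v).det = 0 ↔
      ∃ (w : Fin (n + 1) → ℝ) (μ : ℝ), w ≠ 0 ∧ ∀ i, lorentz (v i) w = μ := by
  rw [← Matrix.exists_mulVec_eq_zero_iff]
  constructor
  · rintro ⟨z, hz, h⟩
    have hsum (i : Fin (n + 2)) : ∑ k : Fin n, v i k.castSucc * z k.castSucc.castSucc +
        v i (Fin.last n) * z (Fin.last n).castSucc + z (Fin.last (n + 1)) = 0 := by
      simpa [Matrix.mulVec, dotProduct, liftMatrix, Fin.sum_univ_castSucc] using congrFun h i
    refine ⟨Fin.snoc (α := fun _ => ℝ) (fun k : Fin n => z k.castSucc.castSucc)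
      (-z (Fin.last n).castSucc), -z (Fin.last (n + 1)), fun hw => hz ?_, fun i => ?_⟩
    · have hb (k : Fin n) : z k.castSucc.castSucc = 0 := by
        simpa using congrFun hw k.castSucc
      have hl : z (Fin.last n).castSucc = 0 := by
        simpa using congrFun hw (Fin.last n)
      have ht : z (Fin.last (n + 1)) = 0 := by simpa [hb, hl] using hsum 0
      funext i
      exact Fin.lastCases ht (fun i => Fin.lastCases hl hb i) i
    · simp only [lorentz, Fin.snoc_castSucc, Fin.snoc_last]
      linarith [hsum i]
  · rintro ⟨w, μ, hw, h⟩
    refine ⟨Fin.snoc (α := fun _ => ℝ) (Fin.snoc (α := fun _ => ℝ)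
      (fun k : Fin n => w k.castSucc) (-w (Fin.last n))) (-μ), fun hz => hw ?_, ?_⟩
    · have hb (k : Fin n) : w k.castSucc = 0 := by
        simpa using congrFun hz k.castSucc.castSucc
      have hl : w (Fin.last n) = 0 := by
        simpa using congrFun hz (Fin.last n).castSucc
      funext i
      exact Fin.lastCases hl hb i
    · funext i
      have hi := h i
      simp only [lorentz] at hi
      simp only [Matrix.mulVec, dotProduct, liftMatrix, Matrix.of_apply, Fin.sum_univ_castSucc,
        Fin.snoc_castSucc, Fin.snoc_last, Pi.zero_apply]
      linarith

/-- A point of hyperbolic space on the level set `⟨x, w⟩ = μ` with `μ² + ‖w‖² ≤ 0` is the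
point `-w / μ`. -/
theorem eq_of_lorentz_eq_of_nonpos {n : ℕ} {x w : Fin (n + 1) → ℝ} {μ : ℝ}
    (hx : lorentz x x = -1) (hpos : 0 < x (Fin.last n)) (hw : w ≠ 0)
    (hle : μ ^ 2 + lorentz w w ≤ 0) (h : lorentz x w = μ) :
    x = fun k => -w k / μ := by
  set x₀ := x (Fin.last n) with hx₀
  set w₀ := w (Fin.last n) with hw₀
  have hexp : ∑ k : Fin n, (x₀ * w k.castSucc - w₀ * x k.castSucc) ^ 2 =
      x₀ ^ 2 * (∑ k : Fin n, w k.castSucc * w k.castSucc) -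
        2 * x₀ * w₀ * (∑ k : Fin n, x k.castSucc * w k.castSucc) +
        w₀ ^ 2 * (∑ k : Fin n, x k.castSucc * x k.castSucc) := by
    simp only [Finset.mul_sum, ← Finset.sum_sub_distrib, ← Finset.sum_add_distrib]
    exact Finset.sum_congr rfl fun k _ => by ring
  have hnonneg : 0 ≤ ∑ k : Fin n, (x₀ * w k.castSucc - w₀ * x k.castSucc) ^ 2 :=
    Finset.sum_nonneg fun k _ => sq_nonneg _
  have htotal : ∑ k : Fin n, (x₀ * w k.castSucc - w₀ * x k.castSucc) ^ 2 +
      (x₀ * μ + w₀) ^ 2 = x₀ ^ 2 * (μ ^ 2 + lorentz w w) := by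
    simp only [lorentz, ← hx₀, ← hw₀] at hx h ⊢
    rw [hexp]
    linear_combination w₀ ^ 2 * hx - 2 * x₀ * w₀ * h
  have hprod : x₀ ^ 2 * (μ ^ 2 + lorentz w w) ≤ 0 :=
    mul_nonpos_of_nonneg_of_nonpos (sq_nonneg _) hle
  have hμ : x₀ * μ + w₀ = 0 :=
    pow_eq_zero_iff two_ne_zero |>.mp (by nlinarith [sq_nonneg (x₀ * μ + w₀)])
  have hzero : ∑ k : Fin n, (x₀ * w k.castSucc - w₀ * x k.castSucc) ^ 2 = 0 := by
    nlinarith [sq_nonneg (x₀ * μ + w₀)]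
  have hk (k : Fin n) : x₀ * w k.castSucc - w₀ * x k.castSucc = 0 :=
    pow_eq_zero_iff two_ne_zero |>.mp
      ((Finset.sum_eq_zero_iff_of_nonneg fun k _ => sq_nonneg _).mp hzero k (Finset.mem_univ k))
  have hμ0 : μ ≠ 0 := by
    rintro rfl
    have hl : w₀ = 0 := by simpa using hμ
    refine hw (funext fun i => Fin.lastCases hl (fun k => ?_) i)
    simpa [hl, hpos.ne'] using hk k
  funext i
  rw [eq_div_iff hμ0]
  refine Fin.lastCases ?_ (fun k => ?_) i
  · linarith
  · refine mul_left_cancel₀ hpos.ne' ?_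
    linear_combination x k.castSucc * hμ + hk k

/-- Every point of hyperbolic space of positive dimension lies on a hyperplane. -/
theorem exists_spacelike_lorentz_eq_zero {n : ℕ} (hn : 0 < n) {x : Fin (n + 1) → ℝ}
    (hx : lorentz x x = -1) :
    ∃ w : Fin (n + 1) → ℝ, 0 < lorentz w w ∧ lorentz x w = 0 := by
  let k : Fin n := ⟨0, hn⟩
  refine ⟨Fin.snoc (α := fun _ => ℝ) (Pi.single k (x (Fin.last n))) (x k.castSucc), ?_, ?_⟩
  · have hle : x k.castSucc * x k.castSucc ≤ ∑ i : Fin n, x i.castSucc * x i.castSucc :=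
      Finset.single_le_sum (f := fun i : Fin n => x i.castSucc * x i.castSucc)
        (fun i _ => mul_self_nonneg _) (Finset.mem_univ k)
    simp only [lorentz] at hx
    simp only [lorentz, Fin.snoc_castSucc, Fin.snoc_last, Pi.single_apply, mul_ite, mul_zero,
      Finset.sum_ite_eq', Finset.mem_univ, if_true]
    linarith
  · simp only [lorentz, Fin.snoc_castSucc, Fin.snoc_last, Pi.single_apply, mul_ite, mul_zero,
      Finset.sum_ite_eq', Finset.mem_univ, if_true]
    ring

/-- Ptolemy's theorem 2, Lorentzian form: for points `v₁, …, v_{n+2}` of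
hyperbolic space, `det B = 0`, where `B_{ij} = −½(⟨v_i,v_j⟩ + 1)`, iff there exist a
nonzero `v` and a real `μ` with `μ² + ‖v‖² > 0` and `⟨v_i, v⟩ = μ` for all `i`
(the points lie on a common horosphere, hypersphere, hyperplane, or one branch of an
equidistant hypersurface). -/
theorem stmt13 (n : ℕ) (hn : 2 ≤ n) (v : Fin (n + 2) → (Fin (n + 1) → ℝ))
    (hv : ∀ i, lorentz (v i) (v i) = -1)
    (hpos : ∀ i, 0 < v i (Fin.last n)) :
    Matrix.det (Matrix.of fun i j : Fin (n + 2) =>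
        -(lorentz (v i) (v j) + 1) / 2) = 0 ↔
      ∃ (w : Fin (n + 1) → ℝ) (μ : ℝ), w ≠ 0 ∧ 0 < μ ^ 2 + lorentz w w ∧
        ∀ i, lorentz (v i) w = μ := by
  rw [det_gram_eq_zero_iff_det_liftMatrix, det_liftMatrix_eq_zero_iff]
  refine ⟨?_, fun ⟨w, μ, hw, _, h⟩ => ⟨w, μ, hw, h⟩⟩
  rintro ⟨w, μ, hw, h⟩
  by_cases hlt : 0 < μ ^ 2 + lorentz w w
  · exact ⟨w, μ, hw, hlt, h⟩
  have heq (i : Fin (n + 2)) : v i = fun k => -w k / μ :=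
    eq_of_lorentz_eq_of_nonpos (hv i) (hpos i) hw (not_lt.mp hlt) (h i)
  obtain ⟨w', hw', h'⟩ := exists_spacelike_lorentz_eq_zero (by omega : 0 < n) (hv 0)
  refine ⟨w', 0, ?_, by simpa using hw', fun i => by rw [heq i, ← heq 0, h']⟩
  rintro rfl
  simp [lorentz] at hw'
end

section
/- Let v₁, …, v_{n+1} be vectors in Lorentzian space ℝ^{n,1} with ‖v_i‖² = 1, and suppose there exists a vector v with ‖v‖² = 1 and ⟨v_i, v⟩ = 1 for all i. Then det C = 0, where C is the (n+1)×(n+1) matrix with entries C_{ij} = ½(⟨v_i, v_j⟩ − 1). -/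
/-- The image of a vector under the diagonal matrix `diag(1, …, 1, -1)`. -/
def lorentzDual {n : ℕ} (y : Fin (n + 1) → ℝ) : Fin (n + 1) → ℝ :=
  Fin.snoc (fun i : Fin n => y i.castSucc) (-y (Fin.last n))

theorem lorentz_eq_dotProduct {n : ℕ} (x y : Fin (n + 1) → ℝ) :
    lorentz x y = x ⬝ᵥ lorentzDual y := by
  simp [lorentz, lorentzDual, dotProduct, Fin.sum_univ_castSucc, sub_eq_add_neg]

theorem lorentz_comm {n : ℕ} (x y : Fin (n + 1) → ℝ) : lorentz x y = lorentz y x := by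
  simp [lorentz, mul_comm]

theorem lorentz_sub_left {n : ℕ} (x y z : Fin (n + 1) → ℝ) :
    lorentz (x - y) z = lorentz x z - lorentz y z := by
  simp only [lorentz_eq_dotProduct, sub_dotProduct]

theorem lorentz_sub_right {n : ℕ} (x y z : Fin (n + 1) → ℝ) :
    lorentz x (y - z) = lorentz x y - lorentz x z := by
  rw [lorentz_comm, lorentz_sub_left, lorentz_comm y, lorentz_comm z]

/-- Vectors orthogonal to a common non-null vector are linearly dependent. -/
theorem det_of_eq_zero_of_lorentz_eq_zero {n : ℕ} (u : Fin (n + 1) → Fin (n + 1) → ℝ)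
    (w : Fin (n + 1) → ℝ) (hw : lorentz w w ≠ 0) (huw : ∀ i, lorentz (u i) w = 0) :
    (Matrix.of u).det = 0 := by
  refine Matrix.exists_mulVec_eq_zero_iff.mp ⟨lorentzDual w, fun h => hw ?_, ?_⟩
  · rw [lorentz_eq_dotProduct, h, dotProduct_zero]
  · ext i
    exact (lorentz_eq_dotProduct (u i) w).symm.trans (huw i)

/-- if `‖v_i‖² = 1` and some `v` with `‖v‖² = 1` satisfies `⟨v_i, v⟩ = 1`
for all `i`, then `det C = 0`, where `C_{ij} = ½(⟨v_i,v_j⟩ − 1)`. -/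
theorem stmt16 (n : ℕ) (v : Fin (n + 1) → (Fin (n + 1) → ℝ))
    (hv : ∀ i, lorentz (v i) (v i) = 1)
    (w : Fin (n + 1) → ℝ) (hw : lorentz w w = 1)
    (hvw : ∀ i, lorentz (v i) w = 1) :
    Matrix.det (Matrix.of fun i j : Fin (n + 1) =>
      (lorentz (v i) (v j) - 1) / 2) = 0 := by
  have hC : (Matrix.of fun i j : Fin (n + 1) => (lorentz (v i) (v j) - 1) / 2) =
      Matrix.of (fun i => v i - w) *
        Matrix.of (fun k j => lorentzDual (v j - w) k / 2) := by
    ext i j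
    have h : lorentz (v i - w) (v j - w) = lorentz (v i) (v j) - 1 := by
      rw [lorentz_sub_left, lorentz_sub_right, lorentz_sub_right, hvw, hw,
        lorentz_comm w, hvw]
      ring
    rw [Matrix.of_apply, ← h, lorentz_eq_dotProduct]
    simp only [Matrix.of_apply, Matrix.mul_apply, dotProduct, Finset.sum_div, mul_div_assoc]
  rw [hC, Matrix.det_mul, det_of_eq_zero_of_lorentz_eq_zero _ w (by simp [hw]), zero_mul]
  intro i
  rw [lorentz_sub_left, hvw, hw, sub_self]
end
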